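/- (Hubbard–Oberste-Vorth) Suppose the quadratic map q is hyperbolic, i.e. its Julia set J(q) is a compact q-invariant set on which q is uniformly expanding. Then there exists ε > 0 such that for every b ∈ ℂ with 0 < |b| < ε, the restriction of H_b to its Julia set J(H_b) is topologically conjugate to the shift map σ on Σ(J(q), q): there is a homeomorphism h : Σ(J(q), q) → J(H_b) with h ∘ σ = H_b ∘ h. -/

import Mathlib

noncomputable section
open Set Metric Topology Filter ENNReal

/-- The quadratic map `q(x) = x² + c`. -/
def qmap (c : ℂ) : ℂ → ℂ := fun x => x ^ 2 + c

/-- The Hénon map `H_b(x,y) = (x² + c − b·y, x)`; `H₀(x,y) = (q(x), x)`. -/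
def henon (c b : ℂ) : ℂ × ℂ → ℂ × ℂ := fun p => (p.1 ^ 2 + c - b * p.2, p.1)

/-- `g(x) = (q(x), x)`. -/
def gmap (c : ℂ) : ℂ → ℂ × ℂ := fun x => (qmap c x, x)

/-- A set `S` is invariant under `f` if `f⁻¹(S) = S`. -/
def Invariant {α : Type*} (f : α → α) (S : Set α) : Prop := f ⁻¹' S = S

/-- `Σ(S, f)`: bi-infinite orbit sequences of `f` lying in `S`, topologized as a
subspace of the product space `ℤ → X`. -/
def SigmaSet {X : Type*} (f : X → X) (S : Set X) : Set (ℤ → X) :=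
  {z | (∀ i, z i ∈ S) ∧ ∀ i, f (z i) = z (i + 1)}

/-- The shift on bi-infinite sequences. -/
def shiftSeq {X : Type*} (z : ℤ → X) : ℤ → X := fun i => z (i + 1)

lemma shiftSeq_mem {X : Type*} {f : X → X} {S : Set X} {z : ℤ → X}
    (hz : z ∈ SigmaSet f S) : shiftSeq z ∈ SigmaSet f S :=
  ⟨fun i => hz.1 (i + 1), fun i => hz.2 (i + 1)⟩

/-- The shift map `σ` as a self-map of `Σ(S, f)`. -/
def sigmaShift {X : Type*} (f : X → X) (S : Set X) :
    (SigmaSet f S) → (SigmaSet f S) :=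
  fun z => ⟨shiftSeq z.1, shiftSeq_mem z.2⟩

/-- The inverse of the Hénon map (for `b ≠ 0`). -/
def henonInv (c b : ℂ) : ℂ × ℂ → ℂ × ℂ := fun p => (p.2, (p.2 ^ 2 + c - p.1) / b)

/-- `K(f)`: points with bounded forward orbit. -/
def Kset {E : Type*} [NormedAddCommGroup E] (f : E → E) : Set E :=
  {z | ∃ R : ℝ, ∀ n : ℕ, ‖f^[n] z‖ ≤ R}

/-- `J(f) = ∂K(f)`. -/
def Jset {E : Type*} [NormedAddCommGroup E] (f : E → E) : Set E := frontier (Kset f)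

/-- The Julia set `J(H_b) = J⁺(H_b) ∩ J⁻(H_b)` of the Hénon map. -/
def henonJulia (c b : ℂ) : Set (ℂ × ℂ) := Jset (henon c b) ∩ Jset (henonInv c b)

/-- A set `S` is uniformly expanding for `f : ℂ → ℂ`:
`∃ C > 0, λ > 1` with `|D(fⁿ)(z)| ≥ C·λⁿ` for all `z ∈ S`, `n ≥ 1`. -/
def IsExpandingOn (f : ℂ → ℂ) (S : Set ℂ) : Prop :=
  ∃ C > 0, ∃ lam > 1, ∀ z ∈ S, ∀ n : ℕ, 1 ≤ n → C * lam ^ n ≤ ‖deriv (f^[n]) z‖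

/-! ### Boundedness of orbits -/

lemma le_of_sq_le_add {ι : Type*} {a : ι → ℝ} {C B : ℝ} (hC : 0 ≤ C) (hB : C + 3 ≤ B)
    (hbdd : BddAbove (range a)) (h : ∀ i, a i ≤ B ∨ ∃ j k, a i ^ 2 ≤ C + a j + a k) (i : ι) :
    a i ≤ B := by
  by_contra! hi
  have hle : ∀ j, a j ≤ ⨆ j, a j := fun j => le_ciSup hbdd j
  set S := ⨆ j, a j
  have hBS : B < S := hi.trans_le (hle i)
  have hsq : √(C + 2 * S) < S := by
    rw [Real.sqrt_lt' (by linarith)]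
    nlinarith
  have : Nonempty ι := ⟨i⟩
  obtain ⟨j, hj⟩ := exists_lt_of_lt_ciSup (max_lt hBS hsq)
  rw [max_lt_iff] at hj
  rcases h j with hj' | ⟨k, l, hkl⟩
  · linarith
  · have h1 := Real.lt_sq_of_sqrt_lt hj.2
    linarith [hle k, hle l]

/-- A function whose bounded orbits admit an a priori bound. -/
def AprioriBound {E : Type*} [NormedAddCommGroup E] (f : E → E) (R : ℝ) : Prop :=
  ∀ p ∈ Kset f, ∀ n : ℕ, ‖f^[n] p‖ ≤ max ‖p‖ R

lemma AprioriBound.of_sq_le {E : Type*} [NormedAddCommGroup E] {f : E → E} {s : E → ℝ} {C R : ℝ}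
    (hC : 0 ≤ C) (hR : C + 3 ≤ R) (h1 : ∀ p, s p ^ 2 ≤ C + ‖f p‖ + ‖p‖)
    (h2 : ∀ p, ‖f p‖ ≤ max (s p) (s (f p))) : AprioriBound f R := by
  rintro p ⟨B, hB⟩
  refine le_of_sq_le_add (a := fun n => ‖f^[n] p‖) hC (hR.trans (le_max_right _ _))
    ⟨B, by rintro _ ⟨n, rfl⟩; exact hB n⟩ ?_
  rintro (_ | n)
  · exact Or.inl (le_max_left _ _)
  · right
    rcases le_max_iff.1 (h2 (f^[n] p)) with h | h
    · refine ⟨n + 1, n, ?_⟩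
      have := h1 (f^[n] p)
      simp only [Function.iterate_succ_apply'] at *
      have h0 := norm_nonneg (f (f^[n] p))
      nlinarith
    · refine ⟨n + 2, n + 1, ?_⟩
      have := h1 (f (f^[n] p))
      simp only [Function.iterate_succ_apply'] at *
      have h0 := norm_nonneg (f (f^[n] p))
      nlinarith

lemma aprioriBound_henon {c b : ℂ} (hb : ‖b‖ ≤ 1) {R : ℝ} (hR : ‖c‖ + 3 ≤ R) :
    AprioriBound (henon c b) R := by
  refine .of_sq_le (s := fun p => ‖p.1‖) (norm_nonneg c) hR ?_ ?_
  · rintro ⟨x, y⟩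
    have e : x ^ 2 = (x ^ 2 + c - b * y) - c + b * y := by ring
    have h1 : ‖x ^ 2 + c - b * y‖ ≤ ‖henon c b (x, y)‖ := norm_fst_le (henon c b (x, y))
    have h2 : ‖y‖ ≤ ‖(x, y)‖ := norm_snd_le (x, y)
    calc ‖x‖ ^ 2 = ‖(x ^ 2 + c - b * y) - c + b * y‖ := by rw [← e, norm_pow]
      _ ≤ ‖x ^ 2 + c - b * y‖ + ‖c‖ + ‖b‖ * ‖y‖ := by
        rw [← norm_mul]
        exact (norm_add_le _ _).trans (add_le_add_left (norm_sub_le _ _) _)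
      _ ≤ ‖c‖ + ‖henon c b (x, y)‖ + ‖(x, y)‖ := by
        nlinarith [norm_nonneg y, norm_nonneg b]
  · rintro ⟨x, y⟩
    simpa [henon, Prod.norm_def] using le_total _ _

lemma aprioriBound_henonInv {c b : ℂ} (hb0 : b ≠ 0) (hb : ‖b‖ ≤ 1) {R : ℝ} (hR : ‖c‖ + 3 ≤ R) :
    AprioriBound (henonInv c b) R := by
  refine .of_sq_le (s := fun p => ‖p.2‖) (norm_nonneg c) hR ?_ ?_
  · rintro ⟨x, y⟩
    have e : y ^ 2 = b * ((y ^ 2 + c - x) / b) - c + x := by field_simp; ring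
    have h1 : ‖(y ^ 2 + c - x) / b‖ ≤ ‖henonInv c b (x, y)‖ := norm_snd_le (henonInv c b (x, y))
    have h2 : ‖x‖ ≤ ‖(x, y)‖ := norm_fst_le (x, y)
    calc ‖y‖ ^ 2 = ‖b * ((y ^ 2 + c - x) / b) - c + x‖ := by rw [← e, norm_pow]
      _ ≤ ‖b‖ * ‖(y ^ 2 + c - x) / b‖ + ‖c‖ + ‖x‖ := by
        rw [← norm_mul]
        exact (norm_add_le _ _).trans (add_le_add_left (norm_sub_le _ _) _)
      _ ≤ ‖c‖ + ‖henonInv c b (x, y)‖ + ‖(x, y)‖ := by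
        nlinarith [norm_nonneg ((y ^ 2 + c - x) / b), norm_nonneg b]
  · rintro ⟨x, y⟩
    simp [henonInv, Prod.norm_def]

lemma AprioriBound.isClosed_Kset {E : Type*} [NormedAddCommGroup E] {f : E → E} {R : ℝ}
    (h : AprioriBound f R) (hf : Continuous f) : IsClosed (Kset f) := by
  have : Kset f = ⋂ n : ℕ, {p | ‖f^[n] p‖ ≤ max ‖p‖ R} := by
    ext p
    simp only [mem_iInter]
    exact ⟨fun hp n => h p hp n, fun hp => ⟨_, hp⟩⟩
  rw [this]
  exact isClosed_iInter fun n => isClosed_le (hf.iterate n).norm (by fun_prop)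

lemma mem_Kset_apply_iff {E : Type*} [NormedAddCommGroup E] {f : E → E} {p : E} :
    f p ∈ Kset f ↔ p ∈ Kset f := by
  constructor
  · rintro ⟨R, hR⟩
    refine ⟨max ‖p‖ R, ?_⟩
    rintro (_ | n)
    · exact le_max_left _ _
    · exact (hR n).trans (le_max_right _ _)
  · rintro ⟨R, hR⟩
    exact ⟨R, fun n => hR (n + 1)⟩

lemma Homeomorph.mem_Jset_apply_iff {E : Type*} [NormedAddCommGroup E] (f : E ≃ₜ E) {p : E} :
    f p ∈ Jset f ↔ p ∈ Jset f := by
  have h : f ⁻¹' Kset f = Kset f := by ext p; exact mem_Kset_apply_iff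
  have := f.preimage_frontier (Kset f)
  rw [h] at this
  exact Set.ext_iff.1 this p

lemma Homeomorph.mem_Jset_symm_apply_iff {E : Type*} [NormedAddCommGroup E] (f : E ≃ₜ E) {p : E} :
    f.symm p ∈ Jset f ↔ p ∈ Jset f := by
  rw [← f.mem_Jset_apply_iff, f.apply_symm_apply]

/-- Cauchy estimate for the derivatives of the iterates at an interior point of `K(f)`. -/
lemma AprioriBound.exists_norm_fderiv_le {E : Type*} [NormedAddCommGroup E] [NormedSpace ℂ E]
    {f : E → E} {R : ℝ} (h : AprioriBound f R)
    (hf : Differentiable ℂ f) {p : E} (hp : p ∈ interior (Kset f)) :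
    ∃ D, ∀ (v : E) (n : ℕ), ‖v‖ ≤ 1 → ‖fderiv ℂ f^[n] p v‖ ≤ D := by
  obtain ⟨r, hr, hball⟩ := Metric.isOpen_iff.1 isOpen_interior p hp
  have hr2 : 0 < r / 2 := by positivity
  refine ⟨max (‖p‖ + r) R / (r / 2), fun v n hv => ?_⟩
  have hfn : Differentiable ℂ f^[n] := hf.iterate n
  have hline : ∀ t : ℂ, HasDerivAt (fun t : ℂ => p + t • v) v t := fun t => by
    simpa using ((hasDerivAt_id t).smul_const v).const_add p
  have hcomp : ∀ t : ℂ, HasDerivAt (fun t : ℂ => f^[n] (p + t • v))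
      (fderiv ℂ f^[n] (p + t • v) v) t := fun t =>
    (hfn (p + t • v)).hasFDerivAt.comp_hasDerivAt t (hline t)
  have key := Complex.norm_deriv_le_of_forall_mem_sphere_norm_le (c := 0)
    (f := fun t : ℂ => f^[n] (p + t • v)) (C := max (‖p‖ + r) R) hr2
    (Differentiable.diffContOnCl fun t => (hcomp t).differentiableAt) ?_
  · rw [(hcomp 0).deriv] at key
    simpa using key
  · intro t ht
    rw [mem_sphere_zero_iff_norm] at ht
    have h1 : ‖t • v‖ ≤ r / 2 := by
      rw [norm_smul, ht]
      nlinarith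
    have h2 : p + t • v ∈ Kset f := by
      refine interior_subset (hball ?_)
      rw [mem_ball, dist_eq_norm]
      simpa using h1.trans_lt (by linarith)
    refine (h _ h2 n).trans (max_le_max ?_ le_rfl)
    exact (norm_add_le _ _).trans (by linarith)

lemma fderiv_iterate_succ_apply {E : Type*} [NormedAddCommGroup E] [NormedSpace ℂ E]
    {f : E → E} (hf : Differentiable ℂ f) (p v : E) (n : ℕ) :
    fderiv ℂ f^[n + 1] p v = fderiv ℂ f (f^[n] p) (fderiv ℂ f^[n] p v) := by
  rw [Function.iterate_succ', fderiv_comp _ (hf _) (hf.iterate n _)]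
  rfl

lemma hasFDerivAt_henon (c b : ℂ) (p : ℂ × ℂ) :
    HasFDerivAt (𝕜 := ℂ) (henon c b)
      (((2 * p.1) • ContinuousLinearMap.fst ℂ ℂ ℂ - b • ContinuousLinearMap.snd ℂ ℂ ℂ).prod
        (ContinuousLinearMap.fst ℂ ℂ ℂ)) p := by
  have h1 : HasFDerivAt (𝕜 := ℂ) (fun p : ℂ × ℂ => p.1) (ContinuousLinearMap.fst ℂ ℂ ℂ) p :=
    hasFDerivAt_fst
  have h2 : HasFDerivAt (𝕜 := ℂ) (fun p : ℂ × ℂ => p.2) (ContinuousLinearMap.snd ℂ ℂ ℂ) p :=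
    hasFDerivAt_snd
  have h3 := (((h1.pow 2).add_const c).sub (h2.const_mul b)).prodMk h1
  have h4 : henon c b = fun p : ℂ × ℂ => (p.1 ^ 2 + c - b * p.2, p.1) := rfl
  rw [h4]
  simpa using h3

lemma hasFDerivAt_henonInv (c b : ℂ) (p : ℂ × ℂ) :
    HasFDerivAt (𝕜 := ℂ) (henonInv c b)
      ((ContinuousLinearMap.snd ℂ ℂ ℂ).prod
        (b⁻¹ • ((2 * p.2) • ContinuousLinearMap.snd ℂ ℂ ℂ - ContinuousLinearMap.fst ℂ ℂ ℂ))) p := by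
  have h1 : HasFDerivAt (𝕜 := ℂ) (fun p : ℂ × ℂ => p.1) (ContinuousLinearMap.fst ℂ ℂ ℂ) p :=
    hasFDerivAt_fst
  have h2 : HasFDerivAt (𝕜 := ℂ) (fun p : ℂ × ℂ => p.2) (ContinuousLinearMap.snd ℂ ℂ ℂ) p :=
    hasFDerivAt_snd
  have h3 := h2.prodMk ((((h2.pow 2).add_const c).sub h1).const_mul b⁻¹)
  have h4 : henonInv c b = fun p : ℂ × ℂ => (p.2, b⁻¹ * (p.2 ^ 2 + c - p.1)) := by
    ext p <;> simp [henonInv, div_eq_inv_mul]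
  rw [h4]
  simpa using h3

lemma interior_Kset_henonInv {c b : ℂ} (hb0 : b ≠ 0) (hb : ‖b‖ < 1) :
    interior (Kset (henonInv c b)) = ∅ := by
  rw [Set.eq_empty_iff_forall_notMem]
  intro p hp
  have hdiff : Differentiable ℂ (henonInv c b) := fun p =>
    (hasFDerivAt_henonInv c b p).differentiableAt
  obtain ⟨D, hD⟩ :=
    (aprioriBound_henonInv (c := c) hb0 hb.le le_rfl).exists_norm_fderiv_le hdiff hp
  have hrec : ∀ (v : ℂ × ℂ) n, fderiv ℂ (henonInv c b)^[n + 1] p v =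
      ((fderiv ℂ (henonInv c b)^[n] p v).2,
        b⁻¹ * (2 * ((henonInv c b)^[n] p).2 * (fderiv ℂ (henonInv c b)^[n] p v).2 -
          (fderiv ℂ (henonInv c b)^[n] p v).1)) := fun v n => by
    rw [fderiv_iterate_succ_apply hdiff, (hasFDerivAt_henonInv c b _).fderiv]
    simp
  have hdet : ∀ n, (fderiv ℂ (henonInv c b)^[n] p (1, 0)).1 *
      (fderiv ℂ (henonInv c b)^[n] p (0, 1)).2 - (fderiv ℂ (henonInv c b)^[n] p (1, 0)).2 *
      (fderiv ℂ (henonInv c b)^[n] p (0, 1)).1 = (b⁻¹) ^ n := by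
    intro n
    induction n with
    | zero => simp
    | succ n ih =>
      rw [hrec, hrec, pow_succ, ← ih]
      ring
  have hbound : ∀ n : ℕ, (‖b‖⁻¹) ^ n ≤ 2 * (D * D) := fun n => by
    have h1 := hD (1, 0) n (by simp)
    have h2 := hD (0, 1) n (by simp)
    have hD0 : 0 ≤ D := (norm_nonneg _).trans h1
    rw [← norm_inv, ← norm_pow, ← hdet n]
    refine (norm_sub_le _ _).trans ?_
    rw [norm_mul, norm_mul, two_mul]
    refine add_le_add (mul_le_mul ?_ ?_ (norm_nonneg _) hD0)
      (mul_le_mul ?_ ?_ (norm_nonneg _) hD0)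
    · exact (norm_fst_le _).trans h1
    · exact (norm_snd_le _).trans h2
    · exact (norm_snd_le _).trans h1
    · exact (norm_fst_le _).trans h2
  obtain ⟨n, hn⟩ := pow_unbounded_of_one_lt (2 * (D * D))
    ((one_lt_inv₀ (norm_pos_iff.2 hb0)).2 hb)
  exact (hn.trans_le (hbound n)).false

lemma notMem_interior_Kset_henon {c b : ℂ} (hb : ‖b‖ ≤ 1) {p : ℂ × ℂ} {ρ : ℕ → ℝ} {lam M : ℝ}
    (hρ1 : ∀ n, 1 ≤ ρ n) (hρM : ∀ n, ρ n ≤ M) (hbM : 1 < lam - ‖b‖ * M)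
    (hyp : ∀ n, lam * ρ n ≤ ρ (n + 1) * ‖2 * ((henon c b)^[n] p).1‖) :
    p ∉ interior (Kset (henon c b)) := by
  intro hp
  have hdiff : Differentiable ℂ (henon c b) := fun p =>
    (hasFDerivAt_henon c b p).differentiableAt
  obtain ⟨D, hD⟩ := (aprioriBound_henon (c := c) hb le_rfl).exists_norm_fderiv_le hdiff hp
  set u : ℕ → ℂ × ℂ := fun n => fderiv ℂ (henon c b)^[n] p (1, 0) with hu
  have hrec : ∀ n, u (n + 1) =
      (2 * ((henon c b)^[n] p).1 * (u n).1 - b * (u n).2, (u n).1) := fun n => by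
    rw [hu]
    beta_reduce
    rw [fderiv_iterate_succ_apply hdiff, (hasFDerivAt_henon c b _).fderiv]
    simp
  have hgrow : ∀ n, (lam - ‖b‖ * M) ^ n ≤ ρ n * ‖(u n).1‖ ∧ ‖(u n).2‖ ≤ ρ n * ‖(u n).1‖ := by
    intro n
    induction n with
    | zero => simpa [hu] using ⟨hρ1 0, zero_le_one.trans (hρ1 0)⟩
    | succ n ih =>
      have hn := hρ1 n
      have hn1 := hρ1 (n + 1)
      have hstep : (lam - ‖b‖ * M) * (ρ n * ‖(u n).1‖) ≤ ρ (n + 1) * ‖(u (n + 1)).1‖ := by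
        have h1 : ‖2 * ((henon c b)^[n] p).1‖ * ‖(u n).1‖ - ‖b‖ * ‖(u n).2‖ ≤
            ‖(u (n + 1)).1‖ := by
          rw [hrec, ← norm_mul, ← norm_mul]
          exact norm_sub_norm_le _ _
        have h2 := mul_le_mul_of_nonneg_right (hyp n) (norm_nonneg (u n).1)
        have h3 := mul_le_mul_of_nonneg_left h1 (zero_le_one.trans hn1)
        have h4 : ρ (n + 1) * (‖b‖ * ‖(u n).2‖) ≤ M * (‖b‖ * (ρ n * ‖(u n).1‖)) := by
          have := ih.2
          have hM := hρM (n + 1)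
          have hM0 : 0 ≤ M := zero_le_one.trans (hn1.trans hM)
          gcongr
        linarith
      have hle : ρ n * ‖(u n).1‖ ≤ (lam - ‖b‖ * M) * (ρ n * ‖(u n).1‖) :=
        le_mul_of_one_le_left (by positivity) hbM.le
      refine ⟨?_, ?_⟩
      · refine le_trans ?_ hstep
        rw [pow_succ']
        exact mul_le_mul_of_nonneg_left ih.1 (by linarith)
      · have : (u (n + 1)).2 = (u n).1 := by rw [hrec]
        rw [this]
        exact (le_mul_of_one_le_left (norm_nonneg _) hn).trans (hle.trans hstep)
  obtain ⟨n, hn⟩ := pow_unbounded_of_one_lt (M * D) hbM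
  have h1 : ‖(u n).1‖ ≤ D := (norm_fst_le _).trans (hD (1, 0) n (by simp))
  have h2 : ρ n * ‖(u n).1‖ ≤ M * D :=
    mul_le_mul (hρM n) h1 (norm_nonneg _) (zero_le_one.trans ((hρ1 n).trans (hρM n)))
  linarith [(hgrow n).1]

/-! ### Perturbation of expanding sequences -/

/-- The bi-infinite orbits of the Hénon map, recorded by their first coordinates. -/
def IsOrbit (c b : ℂ) (x : ℤ → ℂ) : Prop := ∀ i, x (i + 1) = x i ^ 2 + c - b * x (i - 1)

/-- A sequence along which multiplication by `2 * x i` expands the weights `ρ` by `lam`. -/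
structure ExpandingAlong (x : ℤ → ℂ) (ρ : ℤ → ℝ) (lam M : ℝ) : Prop where
  one_lt : 1 < lam
  one_le : ∀ i, 1 ≤ ρ i
  le_max : ∀ i, ρ i ≤ M
  expand : ∀ i, lam * ρ i ≤ ρ (i + 1) * ‖2 * x i‖

namespace ExpandingAlong

variable {c b : ℂ} {x : ℤ → ℂ} {ρ : ℤ → ℝ} {lam M δ : ℝ}

lemma max_nonneg (h : ExpandingAlong x ρ lam M) : 0 ≤ M :=
  zero_le_one.trans ((h.one_le 0).trans (h.le_max 0))

lemma ne_zero (h : ExpandingAlong x ρ lam M) (i : ℤ) : 2 * x i ≠ 0 := by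
  intro h0
  have h1 := h.expand i
  rw [h0, norm_zero, mul_zero] at h1
  nlinarith [h.one_le i, h.one_lt]

lemma norm_le (h : ExpandingAlong x ρ lam M) (i : ℤ) (u : ℂ) {D : ℝ} (hu : ρ i * ‖u‖ ≤ D) :
    ‖u‖ ≤ D :=
  (le_mul_of_one_le_left (norm_nonneg u) (h.one_le i)).trans hu

lemma mul_norm_le (h : ExpandingAlong x ρ lam M) (i : ℤ) (u : ℂ) :
    lam * (ρ i * ‖u‖) ≤ ρ (i + 1) * ‖2 * x i * u‖ := by
  have := mul_le_mul_of_nonneg_right (h.expand i) (norm_nonneg u)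
  rw [norm_mul]
  linarith

lemma weight_mul_le (h : ExpandingAlong x ρ lam M) (i : ℤ) (u : ℂ) {D : ℝ} (hu : ‖u‖ ≤ D) :
    ρ i * ‖u‖ ≤ M * D :=
  mul_le_mul (h.le_max i) hu (norm_nonneg u) h.max_nonneg

/-- The basic contraction estimate for the linearised orbit equation. -/
lemma contraction (h : ExpandingAlong x ρ lam M) (hδ : M * (‖b‖ + 2 * δ) ≤ (lam - 1) / 2)
    {d : ℤ → ℂ} {D : ℝ} (hd : ∀ i, ρ i * ‖d i‖ ≤ D) {i : ℤ} {u s : ℂ} (hs : ‖s‖ ≤ 2 * δ)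
    (hu : 2 * x i * u = d (i + 1) + b * d (i - 1) + s * d i) :
    ρ i * ‖u‖ ≤ (1 + lam) / 2 / lam * D := by
  have hl := h.one_lt
  have hD : ∀ i, ‖d i‖ ≤ D := fun i => h.norm_le i _ (hd i)
  have hD0 : 0 ≤ D := (norm_nonneg _).trans (hD 0)
  have hρ := zero_le_one.trans (h.one_le (i + 1))
  have h1 := h.mul_norm_le i u
  have h2 : ‖b * d (i - 1) + s * d i‖ ≤ ‖b‖ * D + 2 * δ * D := by
    refine (norm_add_le _ _).trans ?_
    rw [norm_mul, norm_mul]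
    have := hD i
    have := hD (i - 1)
    have hδ0 := (norm_nonneg s).trans hs
    gcongr
  have h3 := h.weight_mul_le (i + 1) _ h2
  have h4 : ρ (i + 1) * ‖2 * x i * u‖ ≤ D + M * (‖b‖ * D + 2 * δ * D) := by
    rw [hu, add_assoc]
    have := mul_le_mul_of_nonneg_left (norm_add_le (d (i + 1)) (b * d (i - 1) + s * d i)) hρ
    linarith [hd (i + 1)]
  have h5 := mul_le_mul_of_nonneg_right hδ hD0
  rw [div_mul_eq_mul_div, le_div_iff₀ (by linarith)]
  linarith

lemma rate_nonneg (h : ExpandingAlong x ρ lam M) : 0 ≤ (1 + lam) / 2 / lam := by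
  have := h.one_lt
  positivity

lemma rate_lt_one (h : ExpandingAlong x ρ lam M) : (1 + lam) / 2 / lam < 1 := by
  have := h.one_lt
  rw [div_lt_one (by linarith)]
  linarith

lemma orbit_unique (h : ExpandingAlong x ρ lam M) (hδ : M * (‖b‖ + 2 * δ) ≤ (lam - 1) / 2)
    {y y' : ℤ → ℂ} (hy : IsOrbit c b y) (hy' : IsOrbit c b y')
    (hyx : ∀ i, ‖y i - x i‖ ≤ δ) (hyx' : ∀ i, ‖y' i - x i‖ ≤ δ) : y = y' := by
  have key : ∀ n : ℕ, ∀ i, ρ i * ‖y i - y' i‖ ≤ ((1 + lam) / 2 / lam) ^ n * (M * (δ + δ)) := by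
    intro n
    induction n with
    | zero =>
      intro i
      rw [pow_zero, one_mul]
      refine h.weight_mul_le i _ ?_
      have : y i - y' i = (y i - x i) - (y' i - x i) := by ring
      rw [this]
      exact (norm_sub_le _ _).trans (add_le_add (hyx i) (hyx' i))
    | succ n ih =>
      intro i
      rw [pow_succ', mul_assoc]
      refine h.contraction hδ (s := -((y i - x i) + (y' i - x i))) (d := fun i => y i - y' i) ih
        ?_ ?_
      · rw [norm_neg, two_mul]
        exact (norm_add_le _ _).trans (add_le_add (hyx i) (hyx' i))
      · rw [hy i, hy' i]
        ring
  funext i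
  rw [← sub_eq_zero, ← norm_le_zero_iff]
  have hlim : Tendsto (fun n : ℕ => ((1 + lam) / 2 / lam) ^ n * (M * (δ + δ))) atTop (𝓝 0) := by
    simpa using (tendsto_pow_atTop_nhds_zero_of_lt_one h.rate_nonneg h.rate_lt_one).mul_const
      (M * (δ + δ))
  exact ge_of_tendsto' hlim fun n => h.norm_le i _ (key n i)

/-- The operator whose fixed points `e` are the corrections turning `x` into an orbit. -/
def correction (c b : ℂ) (x e : ℤ → ℂ) : ℤ → ℂ := fun i =>
  (e (i + 1) + b * (x (i - 1) + e (i - 1)) - e i ^ 2 - (x i ^ 2 + c - x (i + 1))) / (2 * x i)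

lemma exists_orbit_near (h : ExpandingAlong x ρ lam M) {η R : ℝ} (hδ0 : 0 ≤ δ)
    (hb : ‖b‖ ≤ η) (hδ : M * (η + 2 * δ) ≤ (lam - 1) / 2)
    (hη : M * (η * R + η) ≤ (lam - 1) / 2 * δ) (hR : ∀ i, ‖x i‖ ≤ R)
    (hx : ∀ i, ‖x i ^ 2 + c - x (i + 1)‖ ≤ η) :
    ∃ y, IsOrbit c b y ∧ ∀ i, ‖y i - x i‖ ≤ δ := by
  have hl := h.one_lt
  have hM := h.max_nonneg
  have hη0 := (norm_nonneg b).trans hb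
  have hδ' : M * (‖b‖ + 2 * δ) ≤ (lam - 1) / 2 := le_trans (by gcongr) hδ
  set E : ℕ → ℤ → ℂ := fun n => (correction c b x)^[n] 0 with hE
  have hE1 : ∀ n i, 2 * x i * E (n + 1) i = E n (i + 1) + b * (x (i - 1) + E n (i - 1)) -
      E n i ^ 2 - (x i ^ 2 + c - x (i + 1)) := fun n i => by
    rw [hE]
    beta_reduce
    rw [Function.iterate_succ_apply', correction, mul_div_cancel₀ _ (h.ne_zero i)]
  have hball : ∀ n i, ρ i * ‖E n i‖ ≤ δ := by
    intro n
    induction n with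
    | zero => intro i; simpa [hE] using hδ0
    | succ n ih =>
      intro i
      have ih' : ∀ i, ‖E n i‖ ≤ δ := fun i => h.norm_le i _ (ih i)
      have h1 := h.mul_norm_le i (E (n + 1) i)
      rw [hE1] at h1
      have h2 : ‖b * (x (i - 1) + E n (i - 1)) - E n i ^ 2 - (x i ^ 2 + c - x (i + 1))‖ ≤
          η * (R + δ) + δ ^ 2 + η := by
        refine (norm_sub_le _ _).trans (add_le_add ((norm_sub_le _ _).trans (add_le_add ?_ ?_))
          (hx i))
        · rw [norm_mul]
          exact mul_le_mul hb ((norm_add_le _ _).trans (add_le_add (hR _) (ih' _)))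
            (norm_nonneg _) hη0
        · rw [norm_pow]
          exact pow_le_pow_left₀ (norm_nonneg _) (ih' i) 2
      have h3 := h.weight_mul_le (i + 1) _ h2
      have h4 := mul_le_mul_of_nonneg_left (norm_add_le (E n (i + 1))
        (b * (x (i - 1) + E n (i - 1)) - E n i ^ 2 - (x i ^ 2 + c - x (i + 1))))
        (zero_le_one.trans (h.one_le (i + 1)))
      have h5 := mul_le_mul_of_nonneg_right hδ hδ0
      have h6 : 0 ≤ M * δ ^ 2 := by positivity
      have h7 : lam * (ρ i * ‖E (n + 1) i‖) ≤ lam * δ := by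
        refine h1.trans ?_
        rw [show ∀ p q r s : ℂ, p + q - r - s = p + (q - r - s) by intros; ring]
        nlinarith [ih (i + 1)]
      exact le_of_mul_le_mul_left h7 (by linarith)
  have hdiff : ∀ n i, ρ i * ‖E n i - E (n + 1) i‖ ≤ ((1 + lam) / 2 / lam) ^ n * (M * (δ + δ)) := by
    intro n
    induction n with
    | zero =>
      intro i
      rw [pow_zero, one_mul]
      refine h.weight_mul_le i _ ((norm_sub_le _ _).trans (add_le_add ?_ ?_))
      · exact h.norm_le i _ (hball _ i)
      · exact h.norm_le i _ (hball _ i)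
    | succ n ih =>
      intro i
      rw [pow_succ', mul_assoc]
      refine h.contraction hδ' (s := -(E n i + E (n + 1) i))
        (d := fun i => E n i - E (n + 1) i) ih ?_ ?_
      · rw [norm_neg, two_mul]
        exact (norm_add_le _ _).trans
          (add_le_add (h.norm_le i _ (hball n i)) (h.norm_le i _ (hball (n + 1) i)))
      · rw [mul_sub, hE1, hE1]
        ring
  have hlim : ∀ i, ∃ e, Tendsto (fun n => E n i) atTop (𝓝 e) := fun i => by
    refine cauchySeq_tendsto_of_complete
      (cauchySeq_of_le_geometric _ (M * (δ + δ)) h.rate_lt_one fun n => ?_)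
    rw [dist_eq_norm, mul_comm]
    exact h.norm_le i _ (hdiff n i)
  choose e he using hlim
  refine ⟨fun i => x i + e i, fun i => ?_, fun i => ?_⟩
  · have h1 := ((he i).comp (tendsto_add_atTop_nat 1)).const_mul (2 * x i)
    have h2 := (((he (i + 1)).add (((he (i - 1)).const_add (x (i - 1))).const_mul b)).sub
      ((he i).pow 2)).sub_const (x i ^ 2 + c - x (i + 1))
    have h3 := tendsto_nhds_unique h1 (h2.congr fun n => (hE1 n i).symm)
    beta_reduce
    linear_combination -h3
  · rw [add_sub_cancel_left]
    exact le_of_tendsto' (he i).norm fun n => h.norm_le i _ (hball n i)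

end ExpandingAlong

/-! ### The adapted metric near the Julia set -/

lemma hasDerivAt_qmap (c z : ℂ) : HasDerivAt (qmap c) (2 * z) z := by
  have h : qmap c = fun x => x ^ 2 + c := rfl
  rw [h]
  simpa using ((hasDerivAt_id z).pow 2).add_const c

lemma differentiable_qmap (c : ℂ) : Differentiable ℂ (qmap c) := fun z =>
  (hasDerivAt_qmap c z).differentiableAt

lemma continuous_qmap (c : ℂ) : Continuous (qmap c) := (differentiable_qmap c).continuous

lemma deriv_qmap_iterate_succ (c : ℂ) (n : ℕ) (z : ℂ) :
    deriv (qmap c)^[n + 1] z = deriv (qmap c)^[n] (qmap c z) * (2 * z) := by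
  rw [Function.iterate_succ]
  exact (((differentiable_qmap c).iterate n _).hasDerivAt.comp z (hasDerivAt_qmap c z)).deriv

lemma continuous_deriv_qmap_iterate (c : ℂ) (n : ℕ) : Continuous (deriv (qmap c)^[n]) :=
  ((differentiable_qmap c).iterate n).contDiff.continuous_deriv (n := 1) le_rfl

/-- A conformal metric adapted to an expanding set. -/
lemma IsExpandingOn.exists_adapted {c : ℂ} {S : Set ℂ} (h : IsExpandingOn (qmap c) S) :
    ∃ ρ : ℂ → ℝ, Continuous ρ ∧ (∀ z, 1 ≤ ρ z) ∧
      ∃ μ > 1, ∀ z ∈ S, μ * ρ z ≤ ρ (qmap c z) * ‖2 * z‖ := by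
  obtain ⟨C, hC, lam, hlam, hexp⟩ := h
  set μ := (1 + lam) / 2 with hμ
  have hμ1 : 1 < μ := by rw [hμ]; linarith
  have hμl : 1 < lam / μ := by rw [one_lt_div (by linarith)]; linarith
  obtain ⟨n, hn⟩ := pow_unbounded_of_one_lt (C⁻¹) hμl
  have hn1 : μ ^ (n + 1) ≤ C * lam ^ (n + 1) := by
    have h1 : C⁻¹ < (lam / μ) ^ (n + 1) := hn.trans (pow_lt_pow_right₀ hμl (Nat.lt_succ_self n))
    rw [div_pow, lt_div_iff₀ (by positivity), inv_mul_lt_iff₀ hC] at h1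
    exact h1.le
  set t : ℕ → ℂ → ℝ := fun k z => μ⁻¹ ^ k * ‖deriv (qmap c)^[k] z‖ with ht
  have ht0 : ∀ z, t 0 z = 1 := fun z => by simp [ht]
  refine ⟨fun z => ∑ k ∈ Finset.range (n + 1), t k z, ?_, fun z => ?_, μ, hμ1, fun z hz => ?_⟩
  · exact continuous_finsetSum _ fun k _ =>
      continuous_const.mul (continuous_deriv_qmap_iterate c k).norm
  · beta_reduce
    rw [Finset.sum_range_succ', ht0]
    exact le_add_of_nonneg_left (Finset.sum_nonneg fun k _ => by simp only [ht]; positivity)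
  · have h1 : ∀ k, t k (qmap c z) * ‖2 * z‖ = μ * t (k + 1) z := fun k => by
      simp only [ht]
      rw [deriv_qmap_iterate_succ, norm_mul _ (2 * z), pow_succ]
      field_simp
    rw [Finset.sum_mul, Finset.sum_congr rfl fun k _ => h1 k, ← Finset.mul_sum]
    refine mul_le_mul_of_nonneg_left ?_ (by linarith)
    have h2 := Finset.sum_range_succ' (fun k => t k z) (n + 1)
    rw [Finset.sum_range_succ] at h2
    have h3 : 1 ≤ t (n + 1) z := by
      simp only [ht]
      rw [inv_pow, inv_mul_eq_div, le_div_iff₀ (by positivity), one_mul]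
      exact hn1.trans (hexp z hz (n + 1) (by omega))
    rw [ht0] at h2
    linarith

lemma exists_expand_near {c : ℂ} {S : Set ℂ} (hS : IsCompact S) {ρ : ℂ → ℝ} (hρ : Continuous ρ)
    (hρ1 : ∀ z, 1 ≤ ρ z) {μ lam : ℝ} (hlam : lam < μ)
    (hexp : ∀ z ∈ S, μ * ρ z ≤ ρ (qmap c z) * ‖2 * z‖) :
    ∃ δ > 0, ∀ w ∈ S, ∀ z z', ‖z - w‖ < δ → ‖z' - qmap c w‖ < δ →
      lam * ρ z ≤ ρ z' * ‖2 * z‖ := by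
  have hcpt : IsCompact ((fun w => (w, qmap c w)) '' S) :=
    hS.image (continuous_id.prodMk (continuous_qmap c))
  have hopen : IsOpen {p : ℂ × ℂ | lam * ρ p.1 < ρ p.2 * ‖2 * p.1‖} :=
    isOpen_lt (by fun_prop) (by fun_prop)
  obtain ⟨δ, hδ, hsub⟩ := hcpt.exists_thickening_subset_open hopen (by
    rintro _ ⟨w, hw, rfl⟩
    have h1 := hexp w hw
    have h2 := hρ1 w
    rw [mem_ofPred_eq]
    nlinarith)
  refine ⟨δ, hδ, fun w hw z z' hz hz' => (hsub (a := (z, z')) ?_).le⟩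
  rw [mem_thickening_iff]
  refine ⟨(w, qmap c w), ⟨w, hw, rfl⟩, ?_⟩
  rw [Prod.dist_eq, dist_eq_norm, dist_eq_norm]
  exact max_lt hz hz'

/-- The neighbourhood of radius `s` of `S` for the conformal metric `ρ`. -/
def nbhd (ρ : ℂ → ℝ) (S : Set ℂ) (s : ℝ) : Set ℂ := {z | ∃ w ∈ S, ρ w * ‖z - w‖ < s}

lemma isOpen_nbhd (ρ : ℂ → ℝ) (S : Set ℂ) (s : ℝ) : IsOpen (nbhd ρ S s) := by
  have : nbhd ρ S s = ⋃ w ∈ S, {z | ρ w * ‖z - w‖ < s} := by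
    ext z; simp [nbhd]
  rw [this]
  exact isOpen_biUnion fun w _ => isOpen_lt (by fun_prop) continuous_const

lemma subset_nbhd (ρ : ℂ → ℝ) (S : Set ℂ) {s : ℝ} (hs : 0 < s) : S ⊆ nbhd ρ S s := fun z hz =>
  ⟨z, hz, by simpa using hs⟩

lemma nbhd_mono (ρ : ℂ → ℝ) (S : Set ℂ) {s t : ℝ} (h : s ≤ t) : nbhd ρ S s ⊆ nbhd ρ S t :=
  fun _ ⟨w, hw, hz⟩ => ⟨w, hw, hz.trans_le h⟩

lemma mem_nbhd_of_norm_sub_le {ρ : ℂ → ℝ} {S : Set ℂ} {M : ℝ} (hρM : ∀ w ∈ S, ρ w ≤ M)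
    (hρ0 : ∀ w, 0 ≤ ρ w) {s τ : ℝ} {z z' : ℂ} (hz : z ∈ nbhd ρ S s) (h : ‖z' - z‖ ≤ τ) :
    z' ∈ nbhd ρ S (s + M * τ) := by
  obtain ⟨w, hw, hzw⟩ := hz
  refine ⟨w, hw, ?_⟩
  have h1 : ‖z' - w‖ ≤ ‖z - w‖ + ‖z' - z‖ := by
    rw [add_comm]
    exact norm_sub_le_norm_sub_add_norm_sub _ _ _
  have h2 := mul_le_mul_of_nonneg_left h1 (hρ0 w)
  have h3 : ρ w * ‖z' - z‖ ≤ M * τ :=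
    mul_le_mul (hρM w hw) h (norm_nonneg _) ((hρ0 w).trans (hρM w hw))
  linarith

/-- `q` expands the distance to a completely invariant expanding set. -/
lemma mem_nbhd_of_qmap_mem_nbhd {c : ℂ} {S : Set ℂ} (hinv : Invariant (qmap c) S) {ρ : ℂ → ℝ}
    {M μ lam κ : ℝ} (hρ1 : ∀ z, 1 ≤ ρ z) (hρM : ∀ w ∈ S, ρ w ≤ M) (hlam : 0 < lam)
    (hexp : ∀ z ∈ S, μ * ρ z ≤ ρ (qmap c z) * ‖2 * z‖) (hκ0 : 0 ≤ κ) (hκ : κ * M ≤ μ - lam)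
    {s : ℝ} (hs : s ≤ κ ^ 2) {z : ℂ} (hz : qmap c z ∈ nbhd ρ S s) : z ∈ nbhd ρ S (s / lam) := by
  obtain ⟨w, hw, hzw⟩ := hz
  obtain ⟨u, hu, huz⟩ : ∃ u, qmap c u = w ∧ ‖z - u‖ ≤ ‖z + u‖ := by
    obtain ⟨u, hu⟩ := IsAlgClosed.exists_pow_nat_eq (w - c) (n := 2) (by norm_num)
    rcases le_total ‖z - u‖ ‖z + u‖ with h | h
    · exact ⟨u, by simp [qmap, hu], h⟩
    · exact ⟨-u, by simp [qmap, hu], by simpa [sub_eq_add_neg] using h⟩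
  have huS : u ∈ S := by
    rw [← hinv, mem_preimage, hu]
    exact hw
  refine ⟨u, huS, ?_⟩
  have hfac : ‖qmap c z - w‖ = ‖z - u‖ * ‖z + u‖ := by
    rw [← hu, ← norm_mul]
    congr 1
    simp only [qmap]
    ring
  have hsmall : ‖z - u‖ ≤ κ := by
    have h1 : ‖qmap c z - w‖ ≤ κ ^ 2 :=
      (le_mul_of_one_le_left (norm_nonneg _) (hρ1 w)).trans (hzw.le.trans hs)
    refine le_of_sq_le_sq ?_ hκ0
    rw [hfac] at h1
    nlinarith [norm_nonneg (z - u)]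
  have hplus : ‖2 * u‖ ≤ ‖z + u‖ + κ := by
    have h1 : 2 * u = (z + u) - (z - u) := by ring
    rw [h1]
    exact (norm_sub_le _ _).trans (by linarith)
  have hkey : lam * ρ u ≤ ρ w * ‖z + u‖ := by
    have h1 := hexp u huS
    rw [hu] at h1
    have h2 := hρ1 w
    have h3 := hρ1 u
    have h4 := hρM w hw
    have h5 := mul_le_mul_of_nonneg_left hplus (zero_le_one.trans h2)
    have h6 : ρ w * κ ≤ M * κ := mul_le_mul_of_nonneg_right h4 hκ0
    have h7 : 0 ≤ M * κ := mul_nonneg (by linarith) hκ0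
    nlinarith
  rw [lt_div_iff₀ hlam]
  rw [hfac] at hzw
  have := mul_le_mul_of_nonneg_right hkey (norm_nonneg (z - u))
  linarith

lemma mem_of_orbit_mem_nbhd {S : Set ℂ} {f : ℂ → ℂ} (hS : IsClosed S) {ρ : ℂ → ℝ}
    (hρ1 : ∀ z, 1 ≤ ρ z) {lam r : ℝ} (hlam : 1 < lam) (hr : 0 ≤ r)
    (hback : ∀ s ≤ r, ∀ z, f z ∈ nbhd ρ S s → z ∈ nbhd ρ S (s / lam))
    {z : ℂ} (hz : ∀ n : ℕ, f^[n] z ∈ nbhd ρ S r) : z ∈ S := by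
  have key : ∀ n : ℕ, ∀ z, f^[n] z ∈ nbhd ρ S r → z ∈ nbhd ρ S (r / lam ^ n) := by
    intro n
    induction n with
    | zero => intro z h; simpa using h
    | succ n ih =>
      intro z h
      rw [pow_succ, ← div_div]
      exact hback _ (div_le_self hr (one_le_pow₀ hlam.le)) z (ih (f z) h)
  rw [← hS.closure_eq, Metric.mem_closure_iff]
  intro ε hε
  obtain ⟨n, hn⟩ := pow_unbounded_of_one_lt (r / ε) hlam
  obtain ⟨w, hw, hzw⟩ := key n z (hz n)
  refine ⟨w, hw, ?_⟩
  rw [dist_eq_norm]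
  refine (le_mul_of_one_le_left (norm_nonneg _) (hρ1 w)).trans_lt (hzw.trans ?_)
  rw [div_lt_iff₀ hε] at hn
  rw [div_lt_iff₀ (by positivity)]
  linarith

/-! ### Orbits away from the Julia set of `q` -/

/-- The Hénon map as a homeomorphism. -/
def henonHomeo (c b : ℂ) (hb : b ≠ 0) : ℂ × ℂ ≃ₜ ℂ × ℂ where
  toFun := henon c b
  invFun := henonInv c b
  left_inv p := by ext <;> simp [henon, henonInv, hb]
  right_inv p := by
    ext
    · simp only [henon, henonInv]
      field_simp
      ring
    · simp [henon, henonInv]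
  continuous_toFun := by unfold henon; fun_prop
  continuous_invFun := by unfold henonInv; fun_prop

lemma norm_le_of_mem_Kset_qmap {c z : ℂ} {R : ℝ} (hR : ‖c‖ + 3 ≤ R) (hz : z ∈ Kset (qmap c)) :
    ‖z‖ ≤ R := by
  obtain ⟨B, hB⟩ := hz
  refine le_of_sq_le_add (a := fun n => ‖(qmap c)^[n] z‖) (norm_nonneg c) hR
    ⟨B, by rintro _ ⟨n, rfl⟩; exact hB n⟩ (fun n => Or.inr ⟨n + 1, n, ?_⟩) 0
  have h1 : ((qmap c)^[n] z) ^ 2 = (qmap c)^[n + 1] z - c := by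
    rw [Function.iterate_succ_apply', qmap]
    ring
  rw [← norm_pow, h1]
  linarith [norm_sub_le ((qmap c)^[n + 1] z) c, norm_nonneg ((qmap c)^[n] z)]

lemma IsPreconnected.subset_of_disjoint_frontier {X : Type*} [TopologicalSpace X] {A K : Set X}
    (hA : IsPreconnected A) (h : Disjoint A (frontier K)) (hne : (A ∩ K).Nonempty) : A ⊆ K := by
  have hcover : A ⊆ interior K ∪ (closure K)ᶜ := fun w hw => by
    by_contra hw'
    rw [mem_union, mem_compl_iff, not_or, not_not] at hw'
    exact h.le_bot ⟨hw, hw'.2, hw'.1⟩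
  obtain ⟨z, hzA, hzK⟩ := hne
  have hz : z ∈ interior K := (hcover hzA).resolve_right fun h => h (subset_closure hzK)
  refine (hA.subset_left_of_subset_union isOpen_interior isClosed_closure.isOpen_compl ?_ hcover
    ⟨z, hzA, hz⟩).trans interior_subset
  exact disjoint_compl_right.mono_left interior_subset_closure

lemma mem_iff_of_closedBall_disjoint_frontier {K : Set ℂ} {z z' : ℂ} {τ : ℝ}
    (h : ∀ w, ‖w - z‖ ≤ τ → w ∉ frontier K) (hz' : ‖z' - z‖ ≤ τ) : z' ∈ K ↔ z ∈ K := by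
  have hconn : IsPreconnected (closedBall z τ) := (convex_closedBall z τ).isPreconnected
  have hdisj : Disjoint (closedBall z τ) (frontier K) := Set.disjoint_left.2 fun w hw =>
    h w (by rwa [mem_closedBall, dist_eq_norm] at hw)
  have hz : z ∈ closedBall z τ := mem_closedBall_self ((norm_nonneg _).trans hz')
  have hz'' : z' ∈ closedBall z τ := by rwa [mem_closedBall, dist_eq_norm]
  exact ⟨fun hK => hconn.subset_of_disjoint_frontier hdisj ⟨z', hz'', hK⟩ hz,
    fun hK => hconn.subset_of_disjoint_frontier hdisj ⟨z, hz, hK⟩ hz''⟩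

/-- Perturbing `q x` does not change its position relative to `K(q)` away from `J(q)`. -/
lemma perturbed_step {c : ℂ} {ρ : ℂ → ℝ} {M lam t τ : ℝ}
    (hρ0 : ∀ z, 0 ≤ ρ z) (hρM : ∀ w ∈ Jset (qmap c), ρ w ≤ M) (ht : 0 < t) (hlam : 0 < lam)
    (hback : ∀ z, qmap c z ∈ nbhd ρ (Jset (qmap c)) (lam * t) →
      z ∈ nbhd ρ (Jset (qmap c)) (lam * t / lam))
    (hτ : M * τ ≤ (lam - 1) * t) {x v : ℂ} (hx : x ∉ nbhd ρ (Jset (qmap c)) t) (hv : ‖v‖ ≤ τ) :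
    (qmap c x - v ∈ Kset (qmap c) ↔ x ∈ Kset (qmap c)) ∧
      qmap c x - v ∉ nbhd ρ (Jset (qmap c)) t := by
  have hqx : qmap c x ∉ nbhd ρ (Jset (qmap c)) (lam * t) := fun h => hx (by
    have := hback x h
    rwa [mul_div_cancel_left₀ _ hlam.ne'] at this)
  have hball : ∀ w, ‖w - qmap c x‖ ≤ τ → w ∉ nbhd ρ (Jset (qmap c)) t := fun w hw hwt => by
    rw [norm_sub_rev] at hw
    exact hqx (nbhd_mono _ _ (by linarith) (mem_nbhd_of_norm_sub_le hρM hρ0 hwt hw))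
  have hv' : ‖qmap c x - v - qmap c x‖ ≤ τ := by simpa using hv
  refine ⟨?_, hball _ hv'⟩
  rw [← mem_Kset_apply_iff (p := x)]
  exact mem_iff_of_closedBall_disjoint_frontier
    (fun w hw hwJ => hball w hw (subset_nbhd _ _ ht hwJ)) hv'

lemma mem_interior_Kset_henon {c b : ℂ} {ρ : ℂ → ℝ} {M lam t R : ℝ} (hR : ‖c‖ + 3 ≤ R)
    (hρ0 : ∀ z, 0 ≤ ρ z) (hρM : ∀ w ∈ Jset (qmap c), ρ w ≤ M) (hM : 0 < M)
    (ht : 0 < t) (hlam : 0 < lam)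
    (hback : ∀ z, qmap c z ∈ nbhd ρ (Jset (qmap c)) (lam * t) →
      z ∈ nbhd ρ (Jset (qmap c)) (lam * t / lam))
    (hb : M * (‖b‖ * (R + 1)) ≤ (lam - 1) * t)
    {p : ℂ × ℂ} (hpK : p.1 ∈ Kset (qmap c)) (hp1 : p.1 ∉ nbhd ρ (Jset (qmap c)) (2 * t))
    (hp2 : ‖p.2‖ ≤ R) : p ∈ interior (Kset (henon c b)) := by
  set T : Set (ℂ × ℂ) :=
    {p | p.1 ∈ Kset (qmap c) ∧ p.1 ∉ nbhd ρ (Jset (qmap c)) t ∧ ‖p.2‖ ≤ R + 1}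
  have hmaps : MapsTo (henon c b) T T := by
    rintro ⟨x, y⟩ ⟨h1, h2, h3⟩
    have hstep := perturbed_step hρ0 hρM ht hlam hback hb h2 (v := b * y) (by
      rw [norm_mul]
      exact mul_le_mul_of_nonneg_left h3 (norm_nonneg b))
    exact ⟨hstep.1.2 h1, hstep.2, (norm_le_of_mem_Kset_qmap hR h1).trans (by linarith)⟩
  have hTK : T ⊆ Kset (henon c b) := fun p hp => by
    refine ⟨R + 1, fun n => ?_⟩
    have hn := hmaps.iterate n hp
    exact max_le ((norm_le_of_mem_Kset_qmap hR hn.1).trans (by linarith)) hn.2.2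
  have hball : ∀ w, ‖w - p.1‖ ≤ t / M → w ∉ nbhd ρ (Jset (qmap c)) t := fun w hw hwt => by
    rw [norm_sub_rev] at hw
    refine hp1 (nbhd_mono _ _ ?_ (mem_nbhd_of_norm_sub_le hρM hρ0 hwt hw))
    rw [mul_div_cancel₀ _ hM.ne']
    linarith
  rw [mem_interior_iff_mem_nhds]
  have hnhds : ball p.1 (t / M) ×ˢ ball p.2 1 ∈ 𝓝 p :=
    prod_mem_nhds (ball_mem_nhds _ (div_pos ht hM)) (ball_mem_nhds _ one_pos)
  refine mem_of_superset hnhds fun p' hp' => hTK ?_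
  obtain ⟨h1, h2⟩ := hp'
  rw [mem_ball, dist_eq_norm] at h1 h2
  refine ⟨?_, hball _ h1.le, ?_⟩
  · exact (mem_iff_of_closedBall_disjoint_frontier
      (fun w hw hwJ => hball w hw (subset_nbhd _ _ ht hwJ)) h1.le).2 hpK
  · linarith [norm_le_norm_add_norm_sub' p'.2 p.2]

lemma continuous_henon_iterate (c : ℂ) (m : ℕ) :
    Continuous fun bp : ℂ × (ℂ × ℂ) => (henon c bp.1)^[m] bp.2 := by
  induction m with
  | zero => exact continuous_snd
  | succ m ih =>
    simp only [Function.iterate_succ_apply']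
    unfold henon at ih ⊢
    fun_prop

lemma henon_zero_iterate_fst (c : ℂ) (m : ℕ) (p : ℂ × ℂ) :
    ((henon c 0)^[m] p).1 = (qmap c)^[m] p.1 := by
  have h : Function.Semiconj Prod.fst (henon c 0) (qmap c) := fun p => by simp [henon, qmap]
  exact h.iterate_right m p

lemma exists_escape (c : ℂ) (ρ : ℂ → ℝ) {r : ℝ} (hr : 0 < r) (R : ℝ) :
    ∃ ε > 0, ∀ b : ℂ, ‖b‖ < ε → ∀ p : ℂ × ℂ, p.1 ∉ Kset (qmap c) →
      p.1 ∉ nbhd ρ (Jset (qmap c)) r → ‖p.1‖ ≤ R → ‖p.2‖ ≤ R →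
      ∃ m : ℕ, R < ‖((henon c b)^[m] p).1‖ := by
  set E : Set ℂ := closedBall 0 R ∩ ((nbhd ρ (Jset (qmap c)) r)ᶜ ∩ (interior (Kset (qmap c)))ᶜ)
  have hEcpt : IsCompact E := (isCompact_closedBall 0 R).inter_right
    ((isOpen_nbhd _ _ _).isClosed_compl.inter isOpen_interior.isClosed_compl)
  have hEK : ∀ z ∈ E, z ∉ Kset (qmap c) := fun z hz hzK =>
    hz.2.1 (subset_nbhd _ _ hr ⟨subset_closure hzK, hz.2.2⟩)
  set U : Set (ℂ × (ℂ × ℂ)) := ⋃ m : ℕ, {bp | R < ‖((henon c bp.1)^[m] bp.2).1‖}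
  have hUo : IsOpen U := isOpen_iUnion fun m =>
    isOpen_lt continuous_const (continuous_henon_iterate c m).fst.norm
  have hsub : ({0} : Set ℂ) ×ˢ (E ×ˢ closedBall (0 : ℂ) R) ⊆ U := by
    rintro ⟨b, p⟩ ⟨hb, hp, -⟩
    rw [mem_singleton_iff] at hb
    have := hEK _ hp
    simp only [Kset, mem_ofPred_eq, not_exists, not_forall, not_le] at this
    obtain ⟨m, hm⟩ := this R
    refine mem_iUnion.2 ⟨m, ?_⟩
    rw [mem_ofPred_eq]
    dsimp only at hb ⊢
    rwa [hb, henon_zero_iterate_fst]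
  obtain ⟨u, v, hu, -, h0u, hv, huv⟩ := generalized_tube_lemma isCompact_singleton
    (hEcpt.prod (isCompact_closedBall (0 : ℂ) R)) hUo hsub
  obtain ⟨ε, hε, hball⟩ := Metric.isOpen_iff.1 hu 0 (h0u rfl)
  refine ⟨ε, hε, fun b hb p hpK hpN hp1 hp2 => ?_⟩
  have hmem : (b, p) ∈ U := by
    refine huv ⟨hball (by simpa using hb), hv ⟨⟨by simpa using hp1, hpN, ?_⟩, by simpa using hp2⟩⟩
    exact fun h => hpK (interior_subset h)
  exact mem_iUnion.1 hmem

/-! ### Bi-infinite orbits -/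

/-- The iterates `H_b^i`, `i ∈ ℤ`. -/
def henonPow (c b : ℂ) (hb : b ≠ 0) (i : ℤ) : Equiv.Perm (ℂ × ℂ) :=
  (henonHomeo c b hb).toEquiv ^ i

section henonPow

variable {c b : ℂ} {hb : b ≠ 0} {p : ℂ × ℂ}

lemma henonPow_succ (i : ℤ) : henonPow c b hb (i + 1) p = henon c b (henonPow c b hb i p) := by
  rw [henonPow, add_comm, zpow_one_add]
  rfl

lemma henonPow_natCast (n : ℕ) : henonPow c b hb n p = (henon c b)^[n] p := by
  induction n with
  | zero => rfl
  | succ n ih => rw [Nat.cast_succ, henonPow_succ, ih, Function.iterate_succ_apply']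

lemma henonPow_neg_natCast (n : ℕ) : henonPow c b hb (-n) p = (henonInv c b)^[n] p := by
  induction n with
  | zero => rfl
  | succ n ih =>
    have h := henonPow_succ (hb := hb) (p := p) (c := c) (-((n + 1 : ℕ) : ℤ))
    rw [show -((n + 1 : ℕ) : ℤ) + 1 = -n by push_cast; ring, ih] at h
    rw [Function.iterate_succ_apply', h]
    exact ((henonHomeo c b hb).symm_apply_apply _).symm

lemma henonPow_mem_iff {S : Set (ℂ × ℂ)} (hS : ∀ p, henon c b p ∈ S ↔ p ∈ S) (i : ℤ) :
    henonPow c b hb i p ∈ S ↔ p ∈ S := by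
  induction i with
  | zero => rfl
  | succ i ih => rw [henonPow_succ, hS, ih]
  | pred i ih => rw [← hS, ← henonPow_succ, sub_add_cancel, ih]

lemma henonPow_snd (i : ℤ) : (henonPow c b hb i p).2 = (henonPow c b hb (i - 1) p).1 := by
  conv_lhs => rw [← sub_add_cancel i 1, henonPow_succ]
  rfl

lemma isOrbit_henonPow : IsOrbit c b fun i => (henonPow c b hb i p).1 := fun i => by
  beta_reduce
  rw [henonPow_succ, ← henonPow_snd]
  rfl

end henonPow

lemma IsOrbit.norm_le {c b : ℂ} {x : ℤ → ℂ} (hx : IsOrbit c b x) (hb : ‖b‖ ≤ 1) {R : ℝ}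
    (hR : ‖c‖ + 3 ≤ R) (hbdd : BddAbove (range fun i => ‖x i‖)) (i : ℤ) : ‖x i‖ ≤ R := by
  refine le_of_sq_le_add (a := fun i => ‖x i‖) (norm_nonneg c) hR hbdd
    (fun i => Or.inr ⟨i + 1, i - 1, ?_⟩) i
  have e : x i ^ 2 = x (i + 1) - c + b * x (i - 1) := by rw [hx i]; ring
  calc ‖x i‖ ^ 2 = ‖x (i + 1) - c + b * x (i - 1)‖ := by rw [← e, norm_pow]
    _ ≤ ‖x (i + 1)‖ + ‖c‖ + ‖b‖ * ‖x (i - 1)‖ := by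
      rw [← norm_mul]
      exact (norm_add_le _ _).trans (add_le_add_left (norm_sub_le _ _) _)
    _ ≤ ‖c‖ + ‖x (i + 1)‖ + ‖x (i - 1)‖ := by
      nlinarith [norm_nonneg (x (i - 1)), norm_nonneg b]

lemma IsOrbit.henon_iterate {c b : ℂ} {x : ℤ → ℂ} (hx : IsOrbit c b x) (n : ℕ) :
    (henon c b)^[n] (x 0, x (-1)) = (x n, x (n - 1)) := by
  induction n with
  | zero => simp
  | succ n ih =>
    rw [Function.iterate_succ_apply', ih]
    simp [henon, hx n]

lemma IsOrbit.henonInv_iterate {c b : ℂ} (hb : b ≠ 0) {x : ℤ → ℂ} (hx : IsOrbit c b x) (n : ℕ) :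
    (henonInv c b)^[n] (x 0, x (-1)) = (x (-n), x (-n - 1)) := by
  induction n with
  | zero => simp
  | succ n ih =>
    rw [Function.iterate_succ_apply', ih]
    have h := hx (-n - 1)
    rw [sub_add_cancel] at h
    have e : -((n + 1 : ℕ) : ℤ) = -n - 1 := by push_cast; ring
    simp only [henonInv, h, e]
    congr 1
    field_simp
    ring

lemma IsOrbit.ext {c b : ℂ} (hb : b ≠ 0) {x x' : ℤ → ℂ} (hx : IsOrbit c b x)
    (hx' : IsOrbit c b x') (h0 : x 0 = x' 0) (h1 : x (-1) = x' (-1)) : x = x' := by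
  funext i
  obtain ⟨n, rfl | rfl⟩ := i.eq_nat_or_neg
  · have := hx.henon_iterate n
    rw [h0, h1, hx'.henon_iterate n] at this
    exact (congrArg Prod.fst this).symm
  · have := hx.henonInv_iterate hb n
    rw [h0, h1, hx'.henonInv_iterate hb n] at this
    exact (congrArg Prod.fst this).symm

/-! ### The conjugacy -/

lemma henon_mem_henonJulia_iff {c b : ℂ} (hb : b ≠ 0) (p : ℂ × ℂ) :
    henon c b p ∈ henonJulia c b ↔ p ∈ henonJulia c b :=
  and_congr (henonHomeo c b hb).mem_Jset_apply_iff (henonHomeo c b hb).symm.mem_Jset_symm_apply_iff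

lemma Jset_subset_Kset_henon {c b : ℂ} (hb : ‖b‖ ≤ 1) :
    Jset (henon c b) ⊆ Kset (henon c b) := by
  refine ((aprioriBound_henon hb le_rfl).isClosed_Kset ?_).frontier_subset
  unfold henon
  fun_prop

lemma Jset_subset_Kset_henonInv {c b : ℂ} (hb0 : b ≠ 0) (hb : ‖b‖ ≤ 1) :
    Jset (henonInv c b) ⊆ Kset (henonInv c b) := by
  refine ((aprioriBound_henonInv hb0 hb le_rfl).isClosed_Kset ?_).frontier_subset
  unfold henonInv
  fun_prop

lemma norm_henonPow_fst_le {c b : ℂ} (hb0 : b ≠ 0) (hb : ‖b‖ ≤ 1) {R : ℝ} (hR : ‖c‖ + 3 ≤ R)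
    {p : ℂ × ℂ} (hp : p ∈ henonJulia c b) (i : ℤ) : ‖(henonPow c b hb0 i p).1‖ ≤ R := by
  refine isOrbit_henonPow.norm_le hb hR ?_ i
  obtain ⟨B, hB⟩ := Jset_subset_Kset_henon hb hp.1
  obtain ⟨B', hB'⟩ := Jset_subset_Kset_henonInv hb0 hb hp.2
  refine ⟨max B B', ?_⟩
  rintro _ ⟨i, rfl⟩
  obtain ⟨n, rfl | rfl⟩ := i.eq_nat_or_neg
  · beta_reduce
    rw [henonPow_natCast]
    exact (norm_fst_le _).trans ((hB n).trans (le_max_left _ _))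
  · beta_reduce
    rw [henonPow_neg_natCast]
    exact (norm_fst_le _).trans ((hB' n).trans (le_max_right _ _))

/-- `H_b`-orbits `δ`-close to orbits in `J(q)` are in bijection with the latter and fill
`J(H_b)`. -/
structure Shadowing (c b : ℂ) (δ : ℝ) : Prop where
  exists_orbit : ∀ z ∈ SigmaSet (qmap c) (Jset (qmap c)),
    ∃ x, IsOrbit c b x ∧ ∀ i, ‖x i - z i‖ ≤ δ
  orbit_unique : ∀ z ∈ SigmaSet (qmap c) (Jset (qmap c)), ∀ x x', IsOrbit c b x →
    IsOrbit c b x' → (∀ i, ‖x i - z i‖ ≤ δ) → (∀ i, ‖x' i - z i‖ ≤ δ) → x = x'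
  base_unique : ∀ z ∈ SigmaSet (qmap c) (Jset (qmap c)),
    ∀ z' ∈ SigmaSet (qmap c) (Jset (qmap c)), ∀ x : ℤ → ℂ,
    (∀ i, ‖x i - z i‖ ≤ δ) → (∀ i, ‖x i - z' i‖ ≤ δ) → z = z'
  mem_henonJulia : ∀ z ∈ SigmaSet (qmap c) (Jset (qmap c)), ∀ x, IsOrbit c b x →
    (∀ i, ‖x i - z i‖ ≤ δ) → (x 0, x (-1)) ∈ henonJulia c b
  exists_base : ∀ p ∈ henonJulia c b, ∃ z ∈ SigmaSet (qmap c) (Jset (qmap c)),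
    ∃ x, IsOrbit c b x ∧ (∀ i, ‖x i - z i‖ ≤ δ) ∧ (x 0, x (-1)) = p

/-- Pairs of an orbit in `J(q)` and an `H_b`-orbit shadowing it. -/
def shadowGraph (c b : ℂ) (δ : ℝ) : Set ((ℤ → ℂ) × (ℤ → ℂ)) :=
  {p | p.1 ∈ SigmaSet (qmap c) (Jset (qmap c)) ∧ IsOrbit c b p.2 ∧ ∀ i, ‖p.2 i - p.1 i‖ ≤ δ}

lemma isCompact_shadowGraph {c : ℂ} (hcomp : IsCompact (Jset (qmap c))) (b : ℂ) (δ : ℝ) :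
    IsCompact (shadowGraph c b δ) := by
  obtain ⟨R, hR⟩ := hcomp.isBounded.exists_norm_le
  have hcpt : IsCompact ((univ.pi fun _ : ℤ => Jset (qmap c)) ×ˢ
      (univ.pi fun _ : ℤ => closedBall (0 : ℂ) (R + δ))) :=
    (isCompact_univ_pi fun _ => hcomp).prod (isCompact_univ_pi fun _ => isCompact_closedBall _ _)
  refine hcpt.of_isClosed_subset ?_ ?_
  · have e : shadowGraph c b δ = ({p | ∀ i, p.1 i ∈ Jset (qmap c)} ∩
        {p | ∀ i, qmap c (p.1 i) = p.1 (i + 1)}) ∩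
        ({p | ∀ i, p.2 (i + 1) = p.2 i ^ 2 + c - b * p.2 (i - 1)} ∩
        {p | ∀ i, ‖p.2 i - p.1 i‖ ≤ δ}) := rfl
    rw [e]
    simp only [ofPred_forall]
    have := continuous_qmap c
    refine ((isClosed_iInter fun i => ?_).inter (isClosed_iInter fun i => ?_)).inter
      ((isClosed_iInter fun i => ?_).inter (isClosed_iInter fun i => ?_))
    · exact hcomp.isClosed.preimage ((continuous_apply i).comp continuous_fst)
    · exact isClosed_eq (by fun_prop) (by fun_prop)
    · exact isClosed_eq (by fun_prop) (by fun_prop)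
    · exact isClosed_le (by fun_prop) (by fun_prop)
  · rintro ⟨z, x⟩ ⟨hz, -, hx⟩
    refine ⟨fun i _ => hz.1 i, fun i _ => ?_⟩
    rw [mem_closedBall_zero_iff]
    have h1 := hR _ (hz.1 i)
    have h2 := hx i
    exact (norm_le_norm_add_norm_sub' _ (z i)).trans (add_le_add h1 h2)

lemma Shadowing.exists_conj {c b : ℂ} {δ : ℝ} (h : Shadowing c b δ) (hb : b ≠ 0)
    (hcomp : IsCompact (Jset (qmap c))) :
    ∃ h : (SigmaSet (qmap c) (Jset (qmap c))) ≃ₜ (henonJulia c b),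
      ∀ z : SigmaSet (qmap c) (Jset (qmap c)),
        (h (sigmaShift (qmap c) (Jset (qmap c)) z) : ℂ × ℂ) = henon c b (h z) := by
  have : CompactSpace (shadowGraph c b δ) :=
    isCompact_iff_compactSpace.1 (isCompact_shadowGraph hcomp b δ)
  set π₁ : shadowGraph c b δ → SigmaSet (qmap c) (Jset (qmap c)) := fun p => ⟨p.1.1, p.2.1⟩
  set π₂ : shadowGraph c b δ → henonJulia c b := fun p =>
    ⟨(p.1.2 0, p.1.2 (-1)), h.mem_henonJulia _ p.2.1 _ p.2.2.1 p.2.2.2⟩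
  have hb₁ : Function.Bijective π₁ := by
    constructor
    · rintro ⟨⟨z, x⟩, hz, hx, hzx⟩ ⟨⟨z', x'⟩, hz', hx', hzx'⟩ heq
      obtain rfl : z = z' := congrArg Subtype.val heq
      obtain rfl := h.orbit_unique z hz x x' hx hx' hzx hzx'
      rfl
    · rintro ⟨z, hz⟩
      obtain ⟨x, hx, hzx⟩ := h.exists_orbit z hz
      exact ⟨⟨⟨z, x⟩, hz, hx, hzx⟩, rfl⟩
  have hb₂ : Function.Bijective π₂ := by
    constructor
    · rintro ⟨⟨z, x⟩, hz, hx, hzx⟩ ⟨⟨z', x'⟩, hz', hx', hzx'⟩ heq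
      have heq' : (x 0, x (-1)) = (x' 0, x' (-1)) := congrArg Subtype.val heq
      obtain rfl := hx.ext hb hx' (congrArg Prod.fst heq') (congrArg Prod.snd heq')
      obtain rfl := h.base_unique z hz z' hz' x hzx hzx'
      rfl
    · rintro ⟨p, hp⟩
      obtain ⟨z, hz, x, hx, hzx, hxp⟩ := h.exists_base p hp
      exact ⟨⟨⟨z, x⟩, hz, hx, hzx⟩, Subtype.ext hxp⟩
  have hc₁ : Continuous π₁ := by fun_prop
  have hc₂ : Continuous π₂ := by
    refine Continuous.subtype_mk ?_ _
    fun_prop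
  let φ₁ := Continuous.homeoOfEquivCompactToT2 (f := Equiv.ofBijective π₁ hb₁) hc₁
  let φ₂ := Continuous.homeoOfEquivCompactToT2 (f := Equiv.ofBijective π₂ hb₂) hc₂
  refine ⟨φ₁.symm.trans φ₂, fun z => ?_⟩
  obtain ⟨⟨⟨z, x⟩, hz, hx, hzx⟩, rfl⟩ := φ₁.surjective z
  have hshift : sigmaShift (qmap c) (Jset (qmap c)) (φ₁ ⟨⟨z, x⟩, hz, hx, hzx⟩) =
      φ₁ ⟨⟨shiftSeq z, shiftSeq x⟩, shiftSeq_mem hz, fun i => by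
        simpa [shiftSeq, sub_add_eq_add_sub] using hx (i + 1), fun i => hzx (i + 1)⟩ := rfl
  rw [hshift, Homeomorph.trans_apply, Homeomorph.trans_apply, φ₁.symm_apply_apply,
    φ₁.symm_apply_apply]
  change (x (0 + 1), x (-1 + 1)) = henon c b (x 0, x (-1))
  have h0 : x (0 + 1) = x 0 ^ 2 + c - b * x (0 - 1) := hx 0
  rw [h0]
  rfl

lemma eventually_mul_lt (A : ℝ) {B : ℝ} (hB : 0 < B) : ∀ᶠ t in 𝓝[>] (0 : ℝ), A * t < B := by
  have h : Tendsto (fun t : ℝ => A * t) (𝓝[>] 0) (𝓝 0) := by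
    have : Continuous fun t : ℝ => A * t := by fun_prop
    simpa using (this.tendsto 0).mono_left nhdsWithin_le_nhds
  exact h.eventually_lt_const hB

lemma exists_shadowing (c : ℂ) (hcomp : IsCompact (Jset (qmap c)))
    (hinv : Invariant (qmap c) (Jset (qmap c))) (hexp : IsExpandingOn (qmap c) (Jset (qmap c))) :
    ∃ ε > 0, ∀ b : ℂ, b ≠ 0 → ‖b‖ < ε → ∃ δ, Shadowing c b δ := by
  obtain ⟨ρ, hρc, hρ1, μ, hμ, hμρ⟩ := hexp.exists_adapted
  have hρ0 : ∀ z, 0 ≤ ρ z := fun z => zero_le_one.trans (hρ1 z)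
  obtain ⟨lam, hlam, hlamμ⟩ := exists_between hμ
  obtain ⟨R₀, hR₀⟩ := hcomp.isBounded.exists_norm_le
  obtain ⟨R, hRR₀, hR⟩ : ∃ R, R₀ ≤ R ∧ ‖c‖ + 3 ≤ R := ⟨_, le_max_left _ _, le_max_right _ _⟩
  have hJR : ∀ w ∈ Jset (qmap c), ‖w‖ ≤ R := fun w hw => (hR₀ w hw).trans hRR₀
  have hRpos : 0 < R := by linarith [norm_nonneg c]
  obtain ⟨M, hM⟩ := (isCompact_closedBall (0 : ℂ) R).exists_bound_of_continuousOn hρc.continuousOn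
  have hρM : ∀ z, ‖z‖ ≤ R → ρ z ≤ M := fun z hz =>
    (le_abs_self _).trans (hM z (mem_closedBall_zero_iff.2 hz))
  have hρMJ : ∀ w ∈ Jset (qmap c), ρ w ≤ M := fun w hw => hρM w (hJR w hw)
  have hMpos : 0 < M := zero_lt_one.trans_le ((hρ1 0).trans (hρM 0 (by simpa using hRpos.le)))
  obtain ⟨δ₀, hδ₀, hnear⟩ := exists_expand_near hcomp hρc hρ1 hlamμ hμρ
  obtain ⟨κ, hκ, hκpos⟩ := ((eventually_mul_lt M (sub_pos.2 hlamμ)).and self_mem_nhdsWithin).exists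
  have hback : ∀ s ≤ κ ^ 2, ∀ z, qmap c z ∈ nbhd ρ (Jset (qmap c)) s →
      z ∈ nbhd ρ (Jset (qmap c)) (s / lam) := fun s hs z hz =>
    mem_nbhd_of_qmap_mem_nbhd hinv hρ1 hρMJ (by linarith) hμρ hκpos.le (by linarith) hs hz
  have hκ2 : 0 < κ ^ 2 := by positivity
  obtain ⟨δ, ⟨⟨hδ1, hδ2⟩, hδ3⟩, hδ⟩ := (((eventually_mul_lt 1 hδ₀).and
    (eventually_mul_lt (4 * M) hκ2)).and
    (eventually_mul_lt (8 * M) (sub_pos.2 hlam))).and self_mem_nhdsWithin |>.exists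
  obtain ⟨t, ⟨⟨⟨ht1, ht2⟩, ht3⟩, ht4⟩, ht⟩ := ((((eventually_mul_lt lam hκ2).and
    (eventually_mul_lt 4 hκ2)).and (eventually_mul_lt (8 * R) hδ₀)).and
    (eventually_mul_lt 2 hδ₀)).and self_mem_nhdsWithin |>.exists
  obtain ⟨η, ⟨hη1, hη2⟩, hη⟩ := ((eventually_mul_lt (4 * M) (sub_pos.2 hlam)).and
    (eventually_mul_lt (2 * M * (R + 1)) (mul_pos (sub_pos.2 hlam) hδ))).and
    self_mem_nhdsWithin |>.exists
  obtain ⟨ε₁, hε₁, hesc⟩ := exists_escape c ρ (r := 2 * t) (by positivity) R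
  obtain ⟨ε, ⟨⟨⟨⟨⟨hε1, hε2⟩, hε3⟩, hε4⟩, hε5⟩, hε6⟩, hε⟩ :=
    ((((((eventually_mul_lt 1 zero_lt_one).and
    (eventually_mul_lt 1 hη)).and (eventually_mul_lt R hη)).and
    (eventually_mul_lt (2 * R) hδ₀)).and
    (eventually_mul_lt (M * (R + 1)) (mul_pos (sub_pos.2 hlam) ht))).and
    (eventually_mul_lt 1 hε₁)).and self_mem_nhdsWithin |>.exists
  refine ⟨ε, hε, fun b hb0 hbε => ⟨δ, ?_⟩⟩
  rw [one_mul] at hδ1 hε1 hε2 hε6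
  have hb1 : ‖b‖ ≤ 1 := by linarith
  have hbη : ‖b‖ ≤ η := by linarith
  have hbR : ‖b‖ * R ≤ η := by nlinarith
  have hbMη : M * ‖b‖ ≤ M * η := mul_le_mul_of_nonneg_left hbη hMpos.le
  have hSig : ∀ z ∈ SigmaSet (qmap c) (Jset (qmap c)),
      ExpandingAlong z (fun i => ρ (z i)) lam M := fun z hz => by
    refine ⟨hlam, fun i => hρ1 _, fun i => hρMJ _ (hz.1 i), fun i => ?_⟩
    refine hnear (z i) (hz.1 i) _ _ (by simpa using hδ₀) ?_
    rw [hz.2 i]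
    simpa using hδ₀
  have hSigOrb : ∀ z ∈ SigmaSet (qmap c) (Jset (qmap c)), IsOrbit c 0 z := fun z hz i => by
    rw [← hz.2 i, qmap]
    ring
  have hbdd : ∀ z ∈ SigmaSet (qmap c) (Jset (qmap c)), ∀ x, IsOrbit c b x →
      (∀ i, ‖x i - z i‖ ≤ δ) → ∀ i, ‖x i‖ ≤ R := fun z hz x hx hzx => by
    refine hx.norm_le hb1 hR ⟨R + δ, ?_⟩
    rintro _ ⟨i, rfl⟩
    exact (norm_le_norm_add_norm_sub' _ (z i)).trans (add_le_add (hJR _ (hz.1 i)) (hzx i))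
  have hfst : ∀ p ∈ henonJulia c b, ∀ i,
      (henonPow c b hb0 i p).1 ∈ nbhd ρ (Jset (qmap c)) (2 * t) := fun p hp i => by
    have hi := (henonPow_mem_iff (hb := hb0) (henon_mem_henonJulia_iff hb0) i).2 hp
    have hnorm := fun j => norm_henonPow_fst_le hb0 hb1 hR hi j
    have h1 := hnorm 0
    have h2 : ‖(henonPow c b hb0 i p).2‖ ≤ R := by
      rw [henonPow_snd]
      exact norm_henonPow_fst_le hb0 hb1 hR hp _
    by_contra hN
    by_cases hK : (henonPow c b hb0 i p).1 ∈ Kset (qmap c)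
    · refine hi.1.2 (mem_interior_Kset_henon hR hρ0 hρMJ hMpos ht (by linarith)
        (hback _ ht1.le) ?_ hK hN h2)
      have : ‖b‖ * (M * (R + 1)) ≤ ε * (M * (R + 1)) := by gcongr
      linarith
    · obtain ⟨m, hm⟩ := hesc b (by linarith) _ hK hN h1 h2
      have h3 := hnorm m
      rw [henonPow_natCast] at h3
      linarith
  refine ⟨fun z hz => ?_, fun z hz x x' hx hx' hzx hzx' => ?_, fun z hz z' hz' x hzx hzx' => ?_,
    fun z hz x hx hzx => ?_, fun p hp => ?_⟩
  · refine (hSig z hz).exists_orbit_near hδ.le hbη (by linarith) (by linarith)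
      (fun i => hJR _ (hz.1 i)) fun i => ?_
    rw [← hz.2 i, qmap, sub_self, norm_zero]
    exact hη.le
  · exact (hSig z hz).orbit_unique (by linarith) hx hx' hzx hzx'
  · refine (hSig z hz).orbit_unique (b := 0) (δ := 2 * δ) (by rw [norm_zero]; linarith)
      (hSigOrb z hz) (hSigOrb z' hz') (fun i => by simpa using hδ.le) fun i => ?_
    have e : z' i - z i = (x i - z i) - (x i - z' i) := by ring
    rw [e, two_mul]
    exact (norm_sub_le _ _).trans (add_le_add (hzx i) (hzx' i))
  · have hxR := hbdd z hz x hx hzx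
    have hfwd : (x 0, x (-1)) ∈ Kset (henon c b) := ⟨R, fun n => by
      rw [hx.henon_iterate]
      exact max_le (hxR _) (hxR _)⟩
    have hbwd : (x 0, x (-1)) ∈ Kset (henonInv c b) := ⟨R, fun n => by
      rw [hx.henonInv_iterate hb0]
      exact max_le (hxR _) (hxR _)⟩
    refine ⟨⟨subset_closure hfwd, ?_⟩, ⟨subset_closure hbwd, ?_⟩⟩
    · refine notMem_interior_Kset_henon (ρ := fun n => ρ (x n)) (lam := lam) (M := M) hb1
        (fun n => hρ1 _) (fun n => hρM _ (hxR _)) (by linarith) fun n => ?_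
      rw [hx.henon_iterate]
      refine hnear (z n) (hz.1 n) _ _ ((hzx n).trans_lt hδ1) ?_
      rw [hz.2 n, Nat.cast_succ]
      exact (hzx _).trans_lt hδ1
    · rw [interior_Kset_henonInv hb0 (by linarith)]
      exact notMem_empty _
  · set x : ℤ → ℂ := fun i => (henonPow c b hb0 i p).1 with hxdef
    have hx : IsOrbit c b x := isOrbit_henonPow
    have hxR : ∀ i, ‖x i‖ ≤ R := norm_henonPow_fst_le hb0 hb1 hR hp
    have hxN := hfst p hp
    have hbx : ∀ i, ‖b * x i‖ ≤ ‖b‖ * R := fun i => by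
      rw [norm_mul]
      exact mul_le_mul_of_nonneg_left (hxR i) (norm_nonneg b)
    have hxE : ExpandingAlong x (fun i => ρ (x i)) lam M := by
      refine ⟨hlam, fun i => hρ1 _, fun i => hρM _ (hxR i), fun i => ?_⟩
      obtain ⟨w, hw, hxw⟩ := hxN i
      have hxw' : ‖x i - w‖ < 2 * t :=
        (le_mul_of_one_le_left (norm_nonneg _) (hρ1 w)).trans_lt hxw
      refine hnear w hw _ _ (by linarith) ?_
      have e : x (i + 1) - qmap c w = (x i - w) * (x i + w) - b * x (i - 1) := by
        rw [hx i, qmap]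
        ring
      have h1 : ‖(x i - w) * (x i + w)‖ ≤ 2 * t * (R + R) := by
        rw [norm_mul]
        exact mul_le_mul hxw'.le ((norm_add_le _ _).trans (add_le_add (hxR i) (hJR w hw)))
          (norm_nonneg _) (by positivity)
      rw [e]
      have h2 := norm_sub_le ((x i - w) * (x i + w)) (b * x (i - 1))
      have h3 := hbx (i - 1)
      nlinarith
    obtain ⟨z, hz, hzx⟩ := hxE.exists_orbit_near (b := 0) (c := c) (η := η) (R := R) hδ.le
      (by rw [norm_zero]; exact hη.le) (by linarith) (by linarith) hxR fun i => by
        have e : x i ^ 2 + c - x (i + 1) = b * x (i - 1) := by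
          rw [hx i]
          ring
        rw [e]
        exact (hbx _).trans hbR
    have hzq : ∀ i, qmap c (z i) = z (i + 1) := fun i => by
      rw [hz i, qmap]
      ring
    have hzit : ∀ (n : ℕ) i, (qmap c)^[n] (z i) = z (i + n) := fun n => by
      induction n with
      | zero => simp
      | succ n ih =>
        intro i
        rw [Function.iterate_succ_apply', ih, hzq, Nat.cast_succ, add_assoc]
    refine ⟨z, ⟨fun i => ?_, hzq⟩, x, hx, fun i => ?_, ?_⟩
    · refine mem_of_orbit_mem_nbhd hcomp.isClosed hρ1 hlam hκ2.le hback fun n => ?_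
      rw [hzit]
      exact nbhd_mono _ _ (by linarith) (mem_nbhd_of_norm_sub_le hρMJ hρ0 (hxN _) (hzx _))
    · rw [norm_sub_rev]
      exact hzx i
    · rw [hxdef]
      beta_reduce
      rw [show (-1 : ℤ) = 0 - 1 by norm_num, ← henonPow_snd]
      rfl

/-- (Hubbard–Oberste-Vorth) If the quadratic map `q` is hyperbolic — its Julia set
`J(q)` is a compact `q`-invariant set on which `q` is uniformly expanding — then
there is `ε > 0` such that for every `b` with `0 < |b| < ε`, `H_b` restricted to its
Julia set `J(H_b)` is topologically conjugate to the shift `σ` on `Σ(J(q), q)`. -/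
theorem hubbard_oberste_vorth (c : ℂ)
    (hcomp : IsCompact (Jset (qmap c)))
    (hinv : Invariant (qmap c) (Jset (qmap c)))
    (hexp : IsExpandingOn (qmap c) (Jset (qmap c))) :
    ∃ ε > 0, ∀ b : ℂ, b ≠ 0 → ‖b‖ < ε →
      ∃ h : (SigmaSet (qmap c) (Jset (qmap c))) ≃ₜ (henonJulia c b),
        ∀ z : SigmaSet (qmap c) (Jset (qmap c)),
          (h (sigmaShift (qmap c) (Jset (qmap c)) z) : ℂ × ℂ) = henon c b (h z) := by
  obtain ⟨ε, hε, h⟩ := exists_shadowing c hcomp hinv hexp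
  refine ⟨ε, hε, fun b hb hbε => ?_⟩
  obtain ⟨δ, hδ⟩ := h b hb hbε
  exact hδ.exists_conj hb hcomp
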